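/- Let G = ⟨a,b_1,…,b_r⟩ be a multi-GGS-group and suppose the directed generator b_1 is defined by a vector e_1 with e_{1,1} = 1 and e_{1,p−1} = m ≠ 1 (a non-symmetric normalized vector). Then the element of st(1) whose ψ-image is ([a,b_1], 1, …, 1) lies in st_G(1)′. -/

import Mathlib

/-!
Automorphisms of the `p`-regular rooted tree, encoded by portraits:
an automorphism is a family of permutations of `Fin p`, one for each vertex
(vertices are finite words over `Fin p`, the root being `[]`).
-/

namespace TreeAut

variable {p : ℕ}

/-- Automorphisms of the `p`-regular rooted tree, given by their portraits. -/
def AutT (p : ℕ) : Type := List (Fin p) → Equiv.Perm (Fin p)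

namespace AutT

/-- The action of a tree automorphism on the vertices (finite words over `Fin p`). -/
def act : AutT p → List (Fin p) → List (Fin p)
  | _, [] => []
  | f, x :: w => f [] x :: act (fun v => f (x :: v)) w

/-- The section of `f` at the level-one vertex `x`; the map
`f ↦ (sections f 0, …, sections f (p-1))` restricted to the first-level
stabilizer is the isomorphism `ψ`. -/
def sections (f : AutT p) : Fin p → AutT p := fun x v => f (x :: v)

instance : One (AutT p) := ⟨fun _ => 1⟩

instance : Mul (AutT p) := ⟨fun f g v => f (act g v) * g v⟩

/-- The action of the inverse automorphism on vertices. -/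
def invAct : AutT p → List (Fin p) → List (Fin p)
  | _, [] => []
  | f, x :: w => (f [])⁻¹ x :: invAct (fun v => f (((f [])⁻¹ x) :: v)) w

instance : Inv (AutT p) := ⟨fun f v => (f (invAct f v))⁻¹⟩

lemma one_apply (v : List (Fin p)) : (1 : AutT p) v = 1 := rfl

lemma mul_apply (f g : AutT p) (v : List (Fin p)) : (f * g) v = f (act g v) * g v := rfl

lemma inv_apply (f : AutT p) (v : List (Fin p)) : f⁻¹ v = (f (invAct f v))⁻¹ := rfl

lemma act_nil (f : AutT p) : act f [] = [] := rfl

lemma act_cons (f : AutT p) (x : Fin p) (w : List (Fin p)) :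
    act f (x :: w) = f [] x :: act (sections f x) w := rfl

lemma sections_mul (f g : AutT p) (x : Fin p) :
    sections (f * g) x = sections f (g [] x) * sections g x :=
  funext fun _ => rfl

lemma act_one : ∀ v : List (Fin p), act (1 : AutT p) v = v
  | [] => rfl
  | x :: w => congrArg (x :: ·) (act_one w)

lemma act_mul (f g : AutT p) : ∀ v : List (Fin p), act (f * g) v = act f (act g v)
  | [] => rfl
  | x :: w => by
      rw [act_cons (f * g), sections_mul, act_mul, act_cons g, act_cons f]
      rfl

lemma invAct_act (f : AutT p) : ∀ v : List (Fin p), invAct f (act f v) = v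
  | [] => rfl
  | x :: w => by
      rw [act_cons]
      show (f [])⁻¹ (f [] x) ::
          invAct (fun v => f (((f [])⁻¹ (f [] x)) :: v)) (act (sections f x) w) = x :: w
      rw [show (f [])⁻¹ (f [] x) = x from Equiv.symm_apply_apply (f []) x]
      exact congrArg (x :: ·) (invAct_act (sections f x) w)

instance : Group (AutT p) where
  mul_assoc f g h := by
    funext v
    show (f * g) (act h v) * h v = f (act (g * h) v) * (g * h) v
    rw [mul_apply, mul_apply, act_mul, mul_assoc]
  one_mul f := by
    funext v
    show (1 : AutT p) (act f v) * f v = f v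
    rw [one_apply, one_mul]
  mul_one f := by
    funext v
    show f (act (1 : AutT p) v) * (1 : AutT p) v = f v
    rw [act_one, one_apply, mul_one]
  inv_mul_cancel f := by
    funext v
    show f⁻¹ (act f v) * f v = (1 : AutT p) v
    rw [inv_apply, invAct_act, one_apply, inv_mul_cancel]

lemma act_length (f : AutT p) : ∀ v : List (Fin p), (act f v).length = v.length
  | [] => rfl
  | _ :: w => congrArg Nat.succ (act_length _ w)

lemma act_act_inv (f : AutT p) (v : List (Fin p)) : act f (act f⁻¹ v) = v := by
  rw [← act_mul, mul_inv_cancel, act_one]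

/-- The pointwise stabilizer `st(n)` of the `n`-th level of the tree. -/
def levelStab (p n : ℕ) : Subgroup (AutT p) where
  carrier := {f | ∀ v : List (Fin p), v.length = n → act f v = v}
  one_mem' := fun v _ => act_one v
  mul_mem' := by
    intro f g hf hg v hv
    rw [act_mul, hg v hv, hf v hv]
  inv_mem' := by
    intro f hf v hv
    have h1 : act f (act f⁻¹ v) = v := act_act_inv f v
    have h2 : act f (act f⁻¹ v) = act f⁻¹ v := hf _ (by rw [act_length, hv])
    exact h2.symm.trans h1

instance levelStab_normal (p n : ℕ) : (levelStab p n).Normal := by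
  constructor
  intro f hf g v hv
  show act (g * f * g⁻¹) v = v
  rw [act_mul, act_mul, hf _ (by rw [act_length, hv]), act_act_inv]

/-- The tuple of sections at the level-two vertices.  Restricted to the
second-level stabilizer this is the map `ψ₂`. -/
def sections2 (f : AutT p) : Fin p → Fin p → AutT p := fun x y v => f (x :: y :: v)

/-- The rooted automorphism defined by a permutation `σ` of `Fin p`. -/
def rooted (σ : Equiv.Perm (Fin p)) : AutT p := fun v => if v = [] then σ else 1

/-- The rooted automorphism `a`, acting at the root by the cycle `(1 2 … p)`. -/
def rootedA (p : ℕ) : AutT p := rooted (finRotate p)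

/-- Auxiliary portrait for the directed automorphism `b_e`. -/
def directedAux (e : Fin (p - 1) → ZMod p) : List (Fin p) → Equiv.Perm (Fin p)
  | [] => 1
  | x :: w =>
      if h : (x : ℕ) < p - 1 then
        (if w = [] then finRotate p ^ ((e ⟨x, h⟩).val) else 1)
      else directedAux e w

/-- The directed automorphism `b_e` defined by the vector `e ∈ 𝔽_p^{p-1}`,
i.e. the unique automorphism with `ψ(b_e) = (a^{e_1}, …, a^{e_{p-1}}, b_e)`. -/
def directed (e : Fin (p - 1) → ZMod p) : AutT p := directedAux e

/-- The multi-GGS-group determined by the vectors `e 1, …, e r`. -/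
def multiGGS (p : ℕ) {r : ℕ} (e : Fin r → Fin (p - 1) → ZMod p) : Subgroup (AutT p) :=
  Subgroup.closure ({rootedA p} ∪ Set.range fun i => directed (e i))

/-- The GGS-group `𝒢` defined by the (nonzero) constant vector `(c, …, c)`. -/
def constGGS (p : ℕ) (c : ZMod p) : Subgroup (AutT p) :=
  Subgroup.closure {rootedA p, directed (fun _ => c)}

/-- `G` is the GGS-group `𝒢` defined by a constant vector. -/
def IsConstGGS {p : ℕ} (G : Subgroup (AutT p)) : Prop :=
  ∃ c : ZMod p, c ≠ 0 ∧ G = constGGS p c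

/-- The stabilizer `st_G(n) = G ∩ st(n)`, viewed as a subgroup of `G`. -/
def stabIn {p : ℕ} (G : Subgroup (AutT p)) (n : ℕ) : Subgroup G :=
  (levelStab p n).comap G.subtype

instance {p : ℕ} (G : Subgroup (AutT p)) (n : ℕ) : (stabIn G n).Normal :=
  Subgroup.Normal.comap (levelStab_normal p n) G.subtype

/-- The congruence subgroup property: every finite-index subgroup of `G`
contains a level stabilizer `st_G(n)`. -/
def HasCSP {p : ℕ} (G : Subgroup (AutT p)) : Prop :=
  ∀ H : Subgroup G, H.FiniteIndex → ∃ n : ℕ, stabIn G n ≤ H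

/-- `G` is just infinite: it is infinite and all its nontrivial normal
subgroups have finite index. -/
def JustInfinite {p : ℕ} (G : Subgroup (AutT p)) : Prop :=
  Infinite G ∧ ∀ N : Subgroup G, N.Normal → N ≠ ⊥ → N.FiniteIndex

end AutT

end TreeAut

open TreeAut AutT Subgroup

section GroupLemmas

open scoped commutatorElement

variable {p : ℕ} {A : Type*} [Group A]

lemma zpow_eq_zpow_of_zmod_eq {a : A} (ha : a ^ p = 1) {i j : ℤ}
    (h : (i : ZMod p) = (j : ZMod p)) : a ^ i = a ^ j := by
  rw [zpow_eq_zpow_iff_modEq]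
  exact ((ZMod.intCast_eq_intCast_iff i j p).1 h).of_dvd
    (Int.natCast_dvd_natCast.2 (orderOf_dvd_of_pow_eq_one ha))

lemma mem_of_zpow_mem [Fact p.Prime] {L : Subgroup A} {c : A} (hc : c ^ p ∈ L) {i : ℤ}
    (hi : (i : ZMod p) ≠ 0) (hci : c ^ i ∈ L) : c ∈ L := by
  have hcop : IsCoprime i (p : ℤ) := by
    rw [isCoprime_comm, Prime.coprime_iff_not_dvd (Nat.prime_iff_prime_int.1 Fact.out)]
    rwa [Ne, ZMod.intCast_zmod_eq_zero_iff_dvd] at hi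
  obtain ⟨u, v, huv⟩ := hcop
  have h : c = (c ^ i) ^ u * (c ^ p) ^ v := by
    rw [← zpow_natCast, ← zpow_mul, ← zpow_mul, ← zpow_add, mul_comm i, mul_comm (p : ℤ), huv,
      zpow_one]
  rw [h]
  exact mul_mem (zpow_mem hci u) (zpow_mem hc v)

lemma commutatorElement_mem_iff_commute_normalizer (L : Subgroup A) (x y : normalizer (L : Set A)) :
    ⁅(x : A), (y : A)⁆ ∈ L ↔
      Commute (x : normalizer (L : Set A) ⧸ L.subgroupOf (normalizer (L : Set A)))
        (y : normalizer (L : Set A) ⧸ L.subgroupOf (normalizer (L : Set A))) := by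
  rw [← commutatorElement_eq_one_iff_commute]
  change _ ↔ ⁅QuotientGroup.mk' (L.subgroupOf (normalizer (L : Set A))) x,
    QuotientGroup.mk' (L.subgroupOf (normalizer (L : Set A))) y⁆ = 1
  rw [← map_commutatorElement, QuotientGroup.mk'_apply, QuotientGroup.eq_one_iff,
    Subgroup.mem_subgroupOf]
  rfl

lemma commute_of_commute_mul_zpow [Fact p.Prime] {a b : A} (hb : b ^ p = 1) {l : ℤ}
    (hl : (l : ZMod p) ≠ 1) (h : Commute (a * b ^ (-l)) (b * a⁻¹)) : Commute a b := by
  set Z := Subgroup.zpowers (a * b ^ (-l)) ⊔ Subgroup.zpowers (b * a⁻¹) with hZ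
  have hx : a * b ^ (-l) ∈ Z := Subgroup.mem_sup_left (Subgroup.mem_zpowers _)
  have hy : b * a⁻¹ ∈ Z := Subgroup.mem_sup_right (Subgroup.mem_zpowers _)
  have hpow (i : ℤ) : (a * b * a⁻¹) ^ i = a * b ^ i * a⁻¹ := conj_zpow
  have hz : a * b * a⁻¹ ∈ Z := by
    refine mem_of_zpow_mem (p := p) (i := 1 - l) ?_ ?_ ?_
    · rw [conj_pow, hb]; simp
    · push_cast
      exact sub_ne_zero.2 hl.symm
    · rw [hpow]
      convert mul_mem hx hy using 1
      group
  have haZ : a ∈ Z := by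
    convert mul_mem (zpow_mem hz l) hx using 1
    rw [hpow]; group
  have hbZ : b ∈ Z := by
    convert mul_mem hy haZ using 1
    group
  have hZle : Z ≤ Subgroup.centralizer {a * b ^ (-l), b * a⁻¹} := by
    simp only [hZ, sup_le_iff, Subgroup.zpowers_le, Subgroup.mem_centralizer_iff,
      Set.mem_insert_iff, Set.mem_singleton_iff, forall_eq_or_imp, forall_eq]
    exact ⟨⟨trivial, h.eq.symm⟩, h.eq, trivial⟩
  have hZZ : Z ≤ Subgroup.centralizer Z := by
    rw [Subgroup.le_centralizer_iff]
    refine sup_le ?_ ?_ <;> rw [Subgroup.zpowers_le, Subgroup.mem_centralizer_iff] <;>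
      intro z hz <;> exact (Subgroup.mem_centralizer_iff.1 (hZle hz) _ (by simp)).symm
  exact Subgroup.mem_centralizer_iff.1 (hZZ hbZ) a haZ

lemma commutatorElement_pow_left {a b : A} (h : Commute ⁅a, b⁆ a) (n : ℕ) :
    ⁅a ^ n, b⁆ = ⁅a, b⁆ ^ n := by
  induction n with
  | zero => simp
  | succ n ih =>
    have : ⁅a ^ (n + 1), b⁆ = a * ⁅a ^ n, b⁆ * a⁻¹ * ⁅a, b⁆ := by
      simp only [commutatorElement_def, pow_succ']; group
    rw [this, ih, (h.pow_left n).symm.eq, mul_inv_cancel_right, pow_succ]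

end GroupLemmas

section Rotation

open scoped commutatorElement

variable {p : ℕ} {A : Type*} [Group A]

/-- Rotation of tuples indexed by `ZMod p`. -/
def rotateHom (p : ℕ) (A : Type*) [Group A] (k : ZMod p) : (ZMod p → A) →* (ZMod p → A) where
  toFun f x := f (x - k)
  map_one' := rfl
  map_mul' _ _ := rfl

lemma rotateHom_apply (k : ZMod p) (f : ZMod p → A) (x : ZMod p) :
    rotateHom p A k f x = f (x - k) := rfl

lemma rotateHom_mulSingle (k j : ZMod p) (h : A) :
    rotateHom p A k (Pi.mulSingle j h) = Pi.mulSingle (j + k) h := by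
  funext x
  simp only [rotateHom_apply, Pi.mulSingle_apply, sub_eq_iff_eq_add]

lemma rotateHom_commutator_mem {S : Subgroup (ZMod p → A)}
    (hS : ∀ k, ∀ f ∈ S, rotateHom p A k f ∈ S) (k : ZMod p) {f : ZMod p → A} (hf : f ∈ ⁅S, S⁆) :
    rotateHom p A k f ∈ ⁅S, S⁆ := by
  have hle : S.map (rotateHom p A k) ≤ S := Subgroup.map_le_iff_le_comap.2 (hS k)
  exact Subgroup.commutator_mono hle hle
    (Subgroup.map_commutator S S (rotateHom p A k) ▸ Subgroup.mem_map_of_mem _ hf)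

/-- The elements `h` such that `(h, 1, …, 1)` belongs to the derived subgroup of `S`. -/
def firstCoordDerived (S : Subgroup (ZMod p → A)) : Subgroup A :=
  ⁅S, S⁆.comap (MonoidHom.mulSingle (fun _ : ZMod p => A) 0)

lemma mulSingle_mem_commutator_iff {S : Subgroup (ZMod p → A)}
    (hS : ∀ k, ∀ f ∈ S, rotateHom p A k f ∈ S) (k : ZMod p) (h : A) :
    Pi.mulSingle k h ∈ ⁅S, S⁆ ↔ h ∈ firstCoordDerived S := by
  constructor <;> intro hh
  · change Pi.mulSingle 0 h ∈ ⁅S, S⁆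
    simpa [rotateHom_mulSingle] using rotateHom_commutator_mem hS (-k) hh
  · simpa [rotateHom_mulSingle] using
      rotateHom_commutator_mem hS k (f := Pi.mulSingle 0 h) hh

lemma apply_zero_mem_normalizer {S : Subgroup (ZMod p → A)} {f : ZMod p → A} (hf : f ∈ S) :
    f 0 ∈ normalizer (firstCoordDerived S : Set A) := by
  let N : Subgroup A := S.map (Pi.evalMonoidHom (fun _ : ZMod p => A) 0)
  suffices N ≤ normalizer (firstCoordDerived S : Set A) from this ⟨f, hf, rfl⟩
  rw [Subgroup.le_normalizer_iff]
  rintro _ ⟨g, hg, rfl⟩ h hh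
  change Pi.mulSingle 0 h ∈ ⁅S, S⁆ at hh
  change Pi.mulSingle 0 (g 0 * h * (g 0)⁻¹) ∈ ⁅S, S⁆
  have : (Pi.mulSingle 0 (g 0 * h * (g 0)⁻¹) : ZMod p → A) =
      ⁅g, Pi.mulSingle 0 h⁆ * Pi.mulSingle 0 h := by
    funext x
    rcases eq_or_ne x 0 with rfl | hx
    · simp [commutatorElement_def]
    · simp [commutatorElement_def, hx]
  rw [this]
  exact mul_mem
    (Subgroup.commutator_mem_commutator hg (Subgroup.commutator_le_self S hh)) hh

lemma commutatorElement_apply_mem {S : Subgroup (ZMod p → A)}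
    (hS : ∀ k, ∀ f ∈ S, rotateHom p A k f ∈ S) {f g : ZMod p → A} (hf : f ∈ S) (hg : g ∈ S)
    (k : ZMod p) (hk : ∀ x ≠ k, Commute (f x) (g x)) : ⁅f k, g k⁆ ∈ firstCoordDerived S := by
  rw [← mulSingle_mem_commutator_iff hS k]
  convert Subgroup.commutator_mem_commutator hf hg using 1
  funext x
  rcases eq_or_ne x k with rfl | hx
  · simp [commutatorElement_def]
  · simp only [Pi.mulSingle_eq_of_ne hx]
    exact (commutatorElement_eq_one_iff_commute.2 (hk x hx)).symm

/-- The telescoping argument: if `c` at position `1` agrees, modulo the derived subgroup, with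
`c ^ n` at position `0`, and `n ≢ 1` modulo `p`, then `(c, 1, …, 1)` is in the derived subgroup. -/
lemma mem_firstCoordDerived_of_telescope [Fact p.Prime] {S : Subgroup (ZMod p → A)}
    (hS : ∀ k, ∀ f ∈ S, rotateHom p A k f ∈ S) {c : A} (hc : c ^ p ∈ firstCoordDerived S)
    {n : ℤ} (hn : (n : ZMod p) ≠ 1)
    (h : (Pi.mulSingle 0 (c ^ (-n)) * Pi.mulSingle 1 c : ZMod p → A) ∈ ⁅S, S⁆) :
    c ∈ firstCoordDerived S := by
  have key (k : ℕ) : (Pi.mulSingle 0 (c ^ (-n ^ k)) * Pi.mulSingle (k : ZMod p) c : ZMod p → A)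
      ∈ ⁅S, S⁆ := by
    induction k with
    | zero =>
      have h1 : (Pi.mulSingle 0 (c ^ (-n ^ 0)) * Pi.mulSingle ((0 : ℕ) : ZMod p) c : ZMod p → A)
          = 1 := by
        simp [← Pi.mulSingle_mul]
      rw [h1]
      exact one_mem _
    | succ k ih =>
      have hrot := rotateHom_commutator_mem hS (k : ZMod p) h
      rw [map_mul, rotateHom_mulSingle, rotateHom_mulSingle, zero_add, add_comm 1] at hrot
      have hcomm : Commute (Pi.mulSingle 0 (c ^ (-n ^ k)) : ZMod p → A)
          (Pi.mulSingle (k : ZMod p) c) := by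
        rw [Pi.commute_iff]
        intro x
        simp only [Pi.mulSingle_apply]
        split_ifs <;> simp [Commute.zpow_left]
      convert mul_mem (zpow_mem ih n) hrot using 1
      rw [hcomm.mul_zpow, ← Pi.mulSingle_zpow, ← Pi.mulSingle_zpow, mul_assoc,
        ← mul_assoc (Pi.mulSingle (k : ZMod p) (c ^ n) : ZMod p → A), ← Pi.mulSingle_mul, ← zpow_add, ← zpow_mul]
      simp [pow_succ]
  have hp := key p
  rw [ZMod.natCast_self, ← Pi.mulSingle_mul, mulSingle_mem_commutator_iff hS,
    ← zpow_add_one] at hp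
  refine mem_of_zpow_mem hc ?_ hp
  push_cast
  rw [ZMod.pow_card]
  exact fun h0 => hn (by linear_combination -h0)

/-- The tuple `(b, a ^ ε 1, …, a ^ ε (p - 1))`, the position of `b` being `0`. -/
def directedTuple (a b : A) (ε : ZMod p → ZMod p) : ZMod p → A :=
  fun x => if x = 0 then b else a ^ (ε x).val

lemma directedTuple_zero (a b : A) (ε : ZMod p → ZMod p) : directedTuple a b ε 0 = b :=
  if_pos rfl

lemma directedTuple_of_ne (a b : A) (ε : ZMod p → ZMod p) {x : ZMod p} (hx : x ≠ 0) :
    directedTuple a b ε x = a ^ ((ε x).val : ℤ) := by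
  rw [directedTuple, if_neg hx, zpow_natCast]

/-- A vector `ε` with `ε 1 = 1` and constant ratio `l` ends in `l ^ (p - 2)`. -/
lemma apply_neg_one_of_geometric [Fact p.Prime] {ε : ZMod p → ZMod p} (h1 : ε 1 = 1)
    {l : ZMod p} (hl : ∀ x, x ≠ 0 → x ≠ -1 → ε (x + 1) = l * ε x) : ε (-1) = l ^ (p - 2) := by
  have hp2 := (Fact.out : p.Prime).two_le
  have key (n : ℕ) (hn : n ≤ p - 2) : ε ((n + 1 : ℕ) : ZMod p) = l ^ n := by
    induction n with
    | zero => simpa using h1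
    | succ n ih =>
      have hne (j : ℕ) (hj0 : 0 < j) (hj : j < p) : (j : ZMod p) ≠ 0 := by
        rw [Ne, ZMod.natCast_eq_zero_iff]
        exact Nat.not_dvd_of_pos_of_lt hj0 hj
      have := hl ((n + 1 : ℕ) : ZMod p) (hne _ (by omega) (by omega)) (fun h => by
        apply hne (n + 2) (by omega) (by omega)
        push_cast at h ⊢
        linear_combination h)
      rw [Nat.cast_add (n + 1) 1, Nat.cast_one, this, ih (by omega), pow_succ']
  rw [← key (p - 2) le_rfl]
  congr 1
  rw [show p - 2 + 1 = p - 1 by omega, Nat.cast_sub (by omega)]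
  simp

lemma commutatorElement_mem_of_geometric [Fact p.Prime] {a b : A} (ha : a ^ p = 1)
    {ε : ZMod p → ZMod p} (h1 : ε 1 = 1) (hm : ε (-1) ≠ 1)
    {S : Subgroup (ZMod p → A)} (hS : ∀ k, ∀ f ∈ S, rotateHom p A k f ∈ S)
    (hs : directedTuple a b ε ∈ S) {l : ZMod p}
    (hl : ∀ x, x ≠ 0 → x ≠ -1 → ε (x + 1) = l * ε x) :
    ⁅a * b ^ (-(l.val : ℤ)), b * a ^ (-((l * ε (-1)).val : ℤ))⁆ ∈ firstCoordDerived S := by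
  set s := directedTuple a b ε with hsdef
  have h2 : (-1 : ZMod p) ≠ 1 := fun h => hm (h.symm ▸ h1)
  have hval1 : (1 : ZMod p).val = 1 := ZMod.val_one p
  set d : ZMod p → A := s * rotateHom p A 1 s ^ (-(l.val : ℤ)) with hd
  have hdS : d ∈ S := mul_mem hs (zpow_mem (hS 1 s hs) _)
  have hdx (x : ZMod p) : d x = s x * s (x - 1) ^ (-(l.val : ℤ)) := rfl
  have hd1 : d 1 = a * b ^ (-(l.val : ℤ)) := by
    rw [hdx, sub_self, hsdef, directedTuple_zero, directedTuple_of_ne _ _ _ one_ne_zero, h1, hval1]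
    simp
  have hd0 : d 0 = b * a ^ (-((l * ε (-1)).val : ℤ)) := by
    rw [hdx, zero_sub, hsdef, directedTuple_zero,
      directedTuple_of_ne _ _ _ (neg_ne_zero.2 one_ne_zero), ← zpow_mul]
    congr 1
    apply zpow_eq_zpow_of_zmod_eq ha
    push_cast
    simp only [ZMod.natCast_zmod_val]
    ring
  have hdne (x : ZMod p) (hx0 : x ≠ 0) (hx1 : x ≠ 1) : d x = 1 := by
    have hx1' : x - 1 ≠ 0 := sub_ne_zero.2 hx1
    rw [hdx, hsdef, directedTuple_of_ne _ _ _ hx0, directedTuple_of_ne _ _ _ hx1', ← zpow_mul,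
      ← zpow_add, ← zpow_zero a]
    apply zpow_eq_zpow_of_zmod_eq ha
    have := hl (x - 1) hx1' (fun h => hx0 (by linear_combination h))
    rw [sub_add_cancel] at this
    push_cast
    simp only [ZMod.natCast_zmod_val, this]
    ring
  have := commutatorElement_apply_mem hS hdS (hS 1 d hdS) 1 (fun x hx => by
    rcases eq_or_ne x 0 with rfl | hx0
    · rw [rotateHom_apply, zero_sub, hdne (-1) (neg_ne_zero.2 one_ne_zero) h2]
      exact Commute.one_right _
    · rw [hdne x hx0 hx]
      exact Commute.one_left _)
  rwa [rotateHom_apply, sub_self, hd1, hd0] at this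

lemma exists_mem_apply_zero_one_of_not_geometric [Fact p.Prime] {a b : A} (ha : a ^ p = 1)
    {ε : ZMod p → ZMod p} (h1 : ε 1 = 1) (hm : ε (-1) ≠ 1)
    {S : Subgroup (ZMod p → A)} (hS : ∀ k, ∀ f ∈ S, rotateHom p A k f ∈ S)
    (hs : directedTuple a b ε ∈ S) {x : ZMod p} (hx0 : x ≠ 0) (hx1 : x ≠ -1)
    (hx : ε (x + 1) ≠ ε 2 * ε x) :
    ∃ u ∈ S, u 0 = 1 ∧ u 1 = a := by
  have h2 : (1 : ZMod p) + 1 ≠ 0 := fun h => hm (by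
    rw [← eq_neg_iff_add_eq_zero] at h
    exact h ▸ h1)
  set s := directedTuple a b ε with hsdef
  have hrot (k j : ZMod p) (hkj : k + j ≠ 0) :
      rotateHom p A (-j) s k = a ^ ((ε (k + j)).val : ℤ) := by
    rw [rotateHom_apply, sub_neg_eq_add, hsdef, directedTuple_of_ne _ _ _ hkj]
  have hx1' : 1 + x ≠ 0 := fun h => hx1 (by linear_combination h)
  have hg0 : rotateHom p A (-1) s 0 = a ^ ((ε 1).val : ℤ) := by
    rw [hrot _ _ (by simp), zero_add]
  have hg1 : rotateHom p A (-1) s 1 = a ^ ((ε 2).val : ℤ) := by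
    rw [hrot _ _ h2, one_add_one_eq_two]
  refine ⟨(rotateHom p A (-x) s * rotateHom p A (-1) s ^ (-((ε x).val : ℤ))) ^
    ((ε (x + 1) - ε 2 * ε x)⁻¹.val : ℤ),
    zpow_mem (mul_mem (hS _ _ hs) (zpow_mem (hS _ _ hs) _)) _, ?_, ?_⟩
  · rw [Pi.pow_apply, Pi.mul_apply, Pi.pow_apply, hg0, hrot _ _ (by simpa using hx0), zero_add,
      ← zpow_mul, ← zpow_add, ← zpow_mul, ← zpow_zero a]
    apply zpow_eq_zpow_of_zmod_eq ha
    push_cast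
    simp [h1]
  · rw [Pi.pow_apply, Pi.mul_apply, Pi.pow_apply, hg1, hrot _ _ hx1',
      ← zpow_mul, ← zpow_add, ← zpow_mul]
    conv_rhs => rw [← zpow_one a]
    apply zpow_eq_zpow_of_zmod_eq ha
    push_cast
    simp only [ZMod.natCast_zmod_val]
    rw [add_comm 1 x, mul_neg, ← sub_eq_add_neg]
    exact mul_inv_cancel₀ (sub_ne_zero.2 hx)

lemma commutatorElement_mem_of_not_geometric [Fact p.Prime] {a b : A} (ha : a ^ p = 1)
    {ε : ZMod p → ZMod p} (h1 : ε 1 = 1) (hm : ε (-1) ≠ 1)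
    {S : Subgroup (ZMod p → A)} (hS : ∀ k, ∀ f ∈ S, rotateHom p A k f ∈ S)
    (hs : directedTuple a b ε ∈ S) (hna : a ∈ normalizer (firstCoordDerived S : Set A))
    (hnb : b ∈ normalizer (firstCoordDerived S : Set A))
    {x : ZMod p} (hx0 : x ≠ 0) (hx1 : x ≠ -1) (hx : ε (x + 1) ≠ ε 2 * ε x) :
    ⁅a, b⁆ ∈ firstCoordDerived S := by
  obtain ⟨u, huS, hu0, hu1⟩ :=
    exists_mem_apply_zero_one_of_not_geometric ha h1 hm hS hs hx0 hx1 hx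
  set s := directedTuple a b ε with hsdef
  set L := firstCoordDerived S
  have hval1 : (1 : ZMod p).val = 1 := ZMod.val_one p
  set n : ℕ := (ε (-1)).val with hn
  set w : ZMod p → A := ⁅s, rotateHom p A 1 s⁆ with hw
  have hwM : w ∈ ⁅S, S⁆ := Subgroup.commutator_mem_commutator hs (hS 1 s hs)
  have hwS : w ∈ S := Subgroup.commutator_le_self S hwM
  have hwx (y : ZMod p) : w y = ⁅s y, s (y - 1)⁆ := rfl
  have hw0 : w 0 = ⁅b, a ^ n⁆ := by
    rw [hwx, zero_sub, hsdef, directedTuple_zero,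
      directedTuple_of_ne _ _ _ (neg_ne_zero.2 one_ne_zero), zpow_natCast]
  have hw1 : w 1 = ⁅a, b⁆ := by
    rw [hwx, sub_self, hsdef, directedTuple_zero, directedTuple_of_ne _ _ _ one_ne_zero, h1, hval1]
    simp
  have hwne (y : ZMod p) (hy0 : y ≠ 0) (hy1 : y ≠ 1) : w y = 1 := by
    rw [hwx, hsdef, directedTuple_of_ne _ _ _ hy0, directedTuple_of_ne _ _ _ (sub_ne_zero.2 hy1),
      commutatorElement_eq_one_iff_commute]
    exact Commute.zpow_zpow_self a _ _
  have hcomm : ⁅⁅a, b⁆, a⁆ ∈ L := by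
    rw [← hw1, ← hu1]
    refine commutatorElement_apply_mem hS hwS huS 1 fun y hy => ?_
    rcases eq_or_ne y 0 with rfl | hy0
    · rw [hu0]; exact Commute.one_right _
    · rw [hwne y hy0 hy]; exact Commute.one_left _
  let α : normalizer (L : Set A) := ⟨a, hna⟩
  let β : normalizer (L : Set A) := ⟨b, hnb⟩
  have hcα := (commutatorElement_mem_iff_commute_normalizer L ⁅α, β⁆ α).1 hcomm
  let π := QuotientGroup.mk' (L.subgroupOf (normalizer (L : Set A)))
  have hπ (z : normalizer (L : Set A)) : π z = 1 ↔ (z : A) ∈ L := by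
    rw [QuotientGroup.mk'_apply, QuotientGroup.eq_one_iff, Subgroup.mem_subgroupOf]
  have hcα' : Commute ⁅π α, π β⁆ (π α) := by
    rw [← map_commutatorElement]; exact hcα
  have hcp : ⁅a, b⁆ ^ p ∈ L := by
    refine (hπ (⁅α, β⁆ ^ p)).1 ?_
    rw [map_pow, map_commutatorElement, ← commutatorElement_pow_left hcα', ← map_pow,
      show α ^ p = 1 from Subtype.ext ha, map_one, commutatorElement_one_left]
  have hcn : ⁅a, b⁆ ^ (-(n : ℤ)) * ⁅b, a ^ n⁆⁻¹ ∈ L := by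
    refine (hπ (⁅α, β⁆ ^ (-(n : ℤ)) * ⁅β, α ^ n⁆⁻¹)).1 ?_
    rw [commutatorElement_inv, map_mul, map_zpow, map_commutatorElement, map_commutatorElement,
      map_pow, commutatorElement_pow_left hcα', zpow_neg, zpow_natCast, inv_mul_cancel]
  refine mem_firstCoordDerived_of_telescope hS hcp (n := n) ?_ ?_
  · rwa [Int.cast_natCast, hn, ZMod.natCast_zmod_val]
  · convert mul_mem ((mulSingle_mem_commutator_iff hS 0 _).2 hcn) hwM using 1
    funext y
    rcases eq_or_ne y 0 with rfl | hy0
    · simp only [Pi.mul_apply, Pi.mulSingle_eq_same, ne_eq, zero_ne_one, not_false_eq_true,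
        Pi.mulSingle_eq_of_ne, mul_one, hw0, inv_mul_cancel_right]
    · rcases eq_or_ne y 1 with rfl | hy1
      · simp [hw1]
      · simp [hwne y hy0 hy1, hy0, hy1]

theorem mulSingle_commutator_mem_of_nonsymmetric [Fact p.Prime] {a b : A} (ha : a ^ p = 1)
    (hb : b ^ p = 1) {ε : ZMod p → ZMod p} (h1 : ε 1 = 1) (hm : ε (-1) ≠ 1)
    {S : Subgroup (ZMod p → A)} (hS : ∀ k, ∀ f ∈ S, rotateHom p A k f ∈ S)
    (hs : directedTuple a b ε ∈ S) : Pi.mulSingle 0 (a⁻¹ * b⁻¹ * a * b) ∈ ⁅S, S⁆ := by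
  have hna : a ∈ normalizer (firstCoordDerived S : Set A) := by
    convert apply_zero_mem_normalizer (hS (-1) _ hs) using 1
    rw [rotateHom_apply, zero_sub, neg_neg, directedTuple_of_ne _ _ _ one_ne_zero, h1,
      ZMod.val_one p]
    simp
  have hnb : b ∈ normalizer (firstCoordDerived S : Set A) := by
    simpa only [directedTuple_zero] using apply_zero_mem_normalizer hs
  set L := firstCoordDerived S
  let α : normalizer (L : Set A) := ⟨a, hna⟩
  let β : normalizer (L : Set A) := ⟨b, hnb⟩
  have hab : ⁅a, b⁆ ∈ L := by
    by_cases hgeo : ∀ x, x ≠ 0 → x ≠ -1 → ε (x + 1) = ε 2 * ε x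
    · have hlast := apply_neg_one_of_geometric h1 hgeo
      have hmem := commutatorElement_mem_of_geometric ha h1 hm hS hs hgeo
      generalize ε 2 = l at hlast hmem
      rcases eq_or_ne l 0 with rfl | hl0
      · simpa using hmem
      · have hl1 : l ≠ 1 := by
          rintro rfl
          exact hm (by simpa using hlast)
        have hinv : l * ε (-1) = 1 := by
          have hp2 := (Fact.out : p.Prime).two_le
          rw [hlast, ← pow_succ', show p - 2 + 1 = p - 1 by omega, ZMod.pow_card_sub_one_eq_one hl0]
        rw [hinv, ZMod.val_one p, Nat.cast_one, zpow_neg_one] at hmem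
        have hc := (commutatorElement_mem_iff_commute_normalizer L
          (α * β ^ (-(l.val : ℤ))) (β * α⁻¹)).1 hmem
        refine (commutatorElement_mem_iff_commute_normalizer L α β).2 ?_
        refine commute_of_commute_mul_zpow (p := p) (l := l.val) ?_ ?_ hc
        · exact congrArg (QuotientGroup.mk' (L.subgroupOf (normalizer (L : Set A))))
            (show β ^ p = 1 from Subtype.ext hb)
        · rwa [Int.cast_natCast, ZMod.natCast_zmod_val]
    · push Not at hgeo
      obtain ⟨x, hx0, hx1, hx⟩ := hgeo
      exact commutatorElement_mem_of_not_geometric ha h1 hm hS hs hna hnb hx0 hx1 hx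
  have hc := ((commutatorElement_mem_iff_commute_normalizer L α β).1 hab).inv_inv
  have := (commutatorElement_mem_iff_commute_normalizer L α⁻¹ β⁻¹).2 hc
  rw [mulSingle_mem_commutator_iff hS]
  simpa [commutatorElement_def] using this

end Rotation

namespace TreeAut.AutT

variable {p : ℕ}

/-- The inverse of `ψ`, with level-one vertices indexed by `ZMod p`. -/
def ofSections (p : ℕ) : (ZMod p → AutT p) →* AutT p where
  toFun f
    | [] => 1
    | x :: v => f ((x : ℕ) : ZMod p) v
  map_one' := by
    funext v
    cases v <;> rfl
  map_mul' f g := by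
    funext v
    cases v <;> rfl

lemma ofSections_nil (f : ZMod p → AutT p) : ofSections p f [] = 1 := rfl

lemma sections_ofSections (f : ZMod p → AutT p) (x : Fin p) :
    sections (ofSections p f) x = f ((x : ℕ) : ZMod p) := rfl

lemma mem_levelStab_one_of_nil {f : AutT p} (hf : f [] = 1) : f ∈ levelStab p 1 := by
  intro v hv
  obtain ⟨x, rfl⟩ := List.length_eq_one_iff.1 hv
  rw [act_cons, hf, act_nil, Equiv.Perm.one_apply]

lemma natCast_finRotate (x : Fin p) : ((finRotate p x : ℕ) : ZMod p) = (x : ℕ) + 1 := by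
  have := x.neZero
  rw [finRotate_apply, Fin.val_add, ZMod.natCast_mod, Nat.cast_add, Fin.val_one', ZMod.natCast_mod,
    Nat.cast_one]

lemma finRotate_pow_self (p : ℕ) : finRotate p ^ p = 1 := by
  rcases lt_or_ge p 2 with h | h
  · interval_cases p <;> exact Subsingleton.elim _ _
  · have := Equiv.Perm.lcm_cycleType (finRotate p)
    rw [cycleType_finRotate_of_le h, Multiset.lcm_singleton, normalize_eq] at this
    exact orderOf_dvd_iff_pow_eq_one.1 this.symm.dvd

lemma rootedA_nil : rootedA p [] = finRotate p := rfl

lemma sections_rootedA (x : Fin p) : sections (rootedA p) x = 1 := by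
  funext v
  simp [sections, rootedA, rooted, one_apply]

lemma rooted_mul (σ τ : Equiv.Perm (Fin p)) : rooted (σ * τ) = rooted σ * rooted τ := by
  funext v
  cases v with
  | nil => rfl
  | cons x w => simp [mul_apply, act_cons, rooted]

lemma rooted_pow (σ : Equiv.Perm (Fin p)) (n : ℕ) : rooted (σ ^ n) = rooted σ ^ n := by
  induction n with
  | zero => funext v; simp [rooted, one_apply]
  | succ n ih => rw [pow_succ, rooted_mul, ih, pow_succ]

lemma rootedA_pow_self (p : ℕ) : rootedA p ^ p = 1 := by
  rw [rootedA, ← rooted_pow, finRotate_pow_self]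
  simpa using rooted_pow (1 : Equiv.Perm (Fin p)) 0

lemma sections_pow {f : AutT p} (hf : f [] = 1) (n : ℕ) :
    (f ^ n) [] = 1 ∧ ∀ x, sections (f ^ n) x = sections f x ^ n := by
  induction n with
  | zero => exact ⟨rfl, fun _ => rfl⟩
  | succ n ih =>
    refine ⟨?_, fun x => ?_⟩
    · rw [pow_succ, mul_apply, act_nil, ih.1, hf, one_mul]
    · rw [pow_succ, sections_mul, hf, Equiv.Perm.one_apply, ih.2, pow_succ]

lemma sections_directed_of_lt (e : Fin (p - 1) → ZMod p) {x : Fin p} (h : (x : ℕ) < p - 1) :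
    sections (directed e) x = rootedA p ^ (e ⟨x, h⟩).val := by
  rw [rootedA, ← rooted_pow]
  funext v
  simp [sections, directed, directedAux, h, rooted]

lemma sections_directed_of_not_lt (e : Fin (p - 1) → ZMod p) {x : Fin p} (h : ¬(x : ℕ) < p - 1) :
    sections (directed e) x = directed e := by
  funext v
  simp [sections, directed, directedAux, h]

lemma directed_pow_self (e : Fin (p - 1) → ZMod p) : directed e ^ p = 1 := by
  obtain ⟨hnil, hsec⟩ := sections_pow (f := directed e) rfl p
  funext v
  induction v with
  | nil => exact hnil
  | cons x v ih =>
    change sections (directed e ^ p) x v = 1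
    rw [hsec]
    by_cases h : (x : ℕ) < p - 1
    · rw [sections_directed_of_lt e h, ← pow_mul, mul_comm, pow_mul, rootedA_pow_self, one_pow,
        one_apply]
    · rw [sections_directed_of_not_lt e h, ih, one_apply]

lemma ofSections_rotateHom_one (f : ZMod p → AutT p) :
    ofSections p (rotateHom p (AutT p) 1 f) = rootedA p * ofSections p f * (rootedA p)⁻¹ := by
  rw [eq_mul_inv_iff_mul_eq]
  funext v
  cases v with
  | nil => simp [mul_apply, act_nil, ofSections_nil]
  | cons x v =>
    change sections (_ * rootedA p) x v = sections (rootedA p * _) x v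
    rw [sections_mul, sections_mul, sections_rootedA, sections_rootedA, mul_one, one_mul,
      sections_ofSections, sections_ofSections, rotateHom_apply, rootedA_nil, natCast_finRotate,
      add_sub_cancel_right]

lemma ofSections_rotateHom_mem {G : Subgroup (AutT p)} (ha : rootedA p ∈ G) [NeZero p]
    (k : ZMod p) {f : ZMod p → AutT p} (hf : ofSections p f ∈ G) :
    ofSections p (rotateHom p (AutT p) k f) ∈ G := by
  rw [← ZMod.natCast_zmod_val k]
  induction k.val with
  | zero =>
    convert hf using 2
    funext x
    simp [rotateHom_apply]
  | succ n ih =>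
    have : rotateHom p (AutT p) (n + 1 : ℕ) f =
        rotateHom p (AutT p) 1 (rotateHom p (AutT p) n f) := by
      funext x
      simp only [rotateHom_apply, Nat.cast_add, Nat.cast_one]
      congr 1
      ring
    rw [this, ofSections_rotateHom_one]
    exact mul_mem (mul_mem ha ih) (inv_mem ha)

/-- The directed automorphism, conjugated by `a`, in terms of its sections. -/
lemma ofSections_directedTuple (hp : 2 ≤ p) (e : Fin (p - 1) → ZMod p) [NeZero p] :
    ofSections p (directedTuple (rootedA p) (directed e) fun x : ZMod p =>
      e ⟨x.val - 1, by have := x.val_lt; omega⟩) =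
      rootedA p * directed e * (rootedA p)⁻¹ := by
  rw [eq_mul_inv_iff_mul_eq]
  funext v
  cases v with
  | nil =>
    rw [mul_apply, mul_apply, act_nil, act_nil, ofSections_nil]
    rfl
  | cons x v =>
    change sections (_ * rootedA p) x v = sections (rootedA p * _) x v
    rw [sections_mul, sections_mul, sections_rootedA, sections_rootedA, mul_one, one_mul,
      sections_ofSections, rootedA_nil, natCast_finRotate, ← Nat.cast_add_one]
    by_cases h : (x : ℕ) < p - 1
    · have hval : (((x : ℕ) + 1 : ℕ) : ZMod p).val = x + 1 := ZMod.val_cast_of_lt (by omega)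
      rw [sections_directed_of_lt e h, directedTuple, if_neg]
      · simp only [hval, Nat.add_sub_cancel]
      · rw [← ZMod.val_eq_zero, hval]
        omega
    · rw [sections_directed_of_not_lt e h, show (x : ℕ) + 1 = p by omega, ZMod.natCast_self,
        directedTuple_zero]

end TreeAut.AutT

/-- If the first directed generator `b₁` of a multi-GGS-group is defined by a
normalized non-symmetric vector (`e_(1,1) = 1`, `e_(1,p-1) = m ≠ 1`), then the
element of `st(1)` with `ψ`-image `([a,b₁],1,…,1)` lies in `st_G(1)'`,
where `[x,y] = x⁻¹y⁻¹xy`. -/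
theorem first_coordinate_commutator_mem_derived_stab
    (p r : ℕ) (hp : p.Prime) (hpodd : Odd p) (hr : 1 ≤ r)
    (e : Fin r → Fin (p - 1) → ZMod p) (he : LinearIndependent (ZMod p) e)
    (m : ZMod p)
    (h11 : e ⟨0, hr⟩ ⟨0, by have := hp.two_le; omega⟩ = 1)
    (h1last : e ⟨0, hr⟩ ⟨p - 2, by have := hp.two_le; omega⟩ = m)
    (hm : m ≠ 1) :
    ∃ f ∈ (⁅levelStab p 1 ⊓ multiGGS p e, levelStab p 1 ⊓ multiGGS p e⁆ : Subgroup (AutT p)),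
      f ∈ levelStab p 1 ∧
      sections f = fun x : Fin p =>
        if x = (⟨0, hp.pos⟩ : Fin p) then
          (rootedA p)⁻¹ * (directed (e ⟨0, hr⟩))⁻¹ * rootedA p * directed (e ⟨0, hr⟩)
        else 1 := by
  have : Fact p.Prime := ⟨hp⟩
  have hp2 := hp.two_le
  have haG : rootedA p ∈ multiGGS p e := subset_closure (Or.inl rfl)
  have hbG : directed (e ⟨0, hr⟩) ∈ multiGGS p e := subset_closure (Or.inr ⟨⟨0, hr⟩, rfl⟩)
  set S := (levelStab p 1 ⊓ multiGGS p e).comap (ofSections p)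
  have hmem (f : ZMod p → AutT p) (hf : ofSections p f ∈ multiGGS p e) : f ∈ S :=
    ⟨mem_levelStab_one_of_nil (ofSections_nil f), hf⟩
  have hmain := mulSingle_commutator_mem_of_nonsymmetric (S := S) (rootedA_pow_self p)
    (directed_pow_self (e ⟨0, hr⟩))
    (ε := fun x : ZMod p => e ⟨0, hr⟩ ⟨x.val - 1, by have := x.val_lt; omega⟩)
    (by simpa [ZMod.val_one p] using h11)
    (by
      have hval : (-1 : ZMod p).val = p - 1 := by
        rw [ZMod.neg_val, if_neg one_ne_zero, ZMod.val_one p]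
      simp only [hval]
      exact fun h => hm (h1last.symm.trans h))
    (fun k f hf => hmem _ (ofSections_rotateHom_mem haG k hf.2))
    (hmem _ (by
      rw [ofSections_directedTuple hp2]
      exact mul_mem (mul_mem haG hbG) (inv_mem haG)))
  refine ⟨ofSections p (Pi.mulSingle 0 ((rootedA p)⁻¹ * (directed (e ⟨0, hr⟩))⁻¹ * rootedA p *
    directed (e ⟨0, hr⟩))), ?_, mem_levelStab_one_of_nil (ofSections_nil _), ?_⟩
  · have hle : S.map (ofSections p) ≤ levelStab p 1 ⊓ multiGGS p e := map_comap_le _ _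
    exact commutator_mono hle hle
      (map_commutator S S (ofSections p) ▸ mem_map_of_mem _ hmain)
  · funext x
    have hx : ((x : ℕ) : ZMod p) = 0 ↔ x = ⟨0, hp.pos⟩ := by
      rw [ZMod.natCast_eq_zero_iff, Fin.ext_iff]
      exact ⟨fun h => Nat.eq_zero_of_dvd_of_lt h x.isLt, fun h => h ▸ dvd_zero p⟩
    rw [sections_ofSections, Pi.mulSingle_apply]
    simp only [hx]
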